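/- Let g : ℝⁿ → ℝ be continuously differentiable, and suppose g and its gradient ∇g have at most polynomial growth. Then ∫_{ℝⁿ} g(x) · x dγₙ(x) = ∫_{ℝⁿ} ∇g(x) dγₙ(x), i.e., the first-order Fourier–Hermite coefficient of g with respect to the standard Gaussian equals the Gaussian expectation of the gradient of g. -/

import Mathlib

open MeasureTheory Real

/-- The standard Gaussian measure on `ℝⁿ`, with density `(2π)^{−n/2} exp(−‖x‖²/2)` with
respect to Lebesgue measure. -/
noncomputable def stdGaussian (n : ℕ) : Measure (EuclideanSpace ℝ (Fin n)) :=
  volume.withDensity fun x =>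
    ENNReal.ofReal ((2 * π) ^ (-(n : ℝ) / 2) * Real.exp (-‖x‖ ^ 2 / 2))

/-- A function has at most polynomial growth if `‖f(x)‖ ≤ C(1 + ‖x‖)^r` for some `C > 0`
and some natural number `r`. -/
def PolyGrowth {E F : Type*} [NormedAddCommGroup E] [NormedAddCommGroup F] (f : E → F) : Prop :=
  ∃ C > (0 : ℝ), ∃ r : ℕ, ∀ x, ‖f x‖ ≤ C * (1 + ‖x‖) ^ r

open scoped RealInnerProductSpace

section

variable {E F : Type*} [NormedAddCommGroup E] [InnerProductSpace ℝ E]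
  [NormedAddCommGroup F] [NormedSpace ℝ F]

/-- Polynomial growth is preserved under multiplication by the identity. -/
lemma PolyGrowth.smul_id {g : E → ℝ} (hg : PolyGrowth g) : PolyGrowth fun x => g x • x := by
  obtain ⟨C, hC, r, h⟩ := hg
  refine ⟨C, hC, r + 1, fun x => ?_⟩
  rw [norm_smul, pow_succ, ← mul_assoc]
  gcongr
  · exact h x
  · linarith

/-- Powers are dominated by Gaussians. -/
lemma one_add_pow_mul_exp_neg_sq_le (r : ℕ) {t : ℝ} (ht : 0 ≤ t) :
    (1 + t) ^ r * exp (-t ^ 2 / 2) ≤ r.factorial * exp 3 * exp (-(1 / 4) * t ^ 2) := by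
  have hpow : (1 + t) ^ r ≤ r.factorial * exp (1 + t) := by
    have := pow_div_factorial_le_exp (1 + t) (by linarith) r
    rwa [div_le_iff₀' (by positivity)] at this
  calc (1 + t) ^ r * exp (-t ^ 2 / 2)
      ≤ r.factorial * exp (1 + t) * exp (-t ^ 2 / 2) := by gcongr
    _ = r.factorial * exp (1 + t + -t ^ 2 / 2) := by rw [exp_add (1 + t), mul_assoc]
    _ ≤ r.factorial * exp (3 + -(1 / 4) * t ^ 2) := by
        refine mul_le_mul_of_nonneg_left (exp_le_exp.2 ?_) (by positivity)
        nlinarith [sq_nonneg (t / 2 - 1)]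
    _ = _ := by rw [exp_add 3, mul_assoc]

lemma hasFDerivAt_gaussian (c : ℝ) (x : E) :
    HasFDerivAt (fun x : E => c * exp (-‖x‖ ^ 2 / 2))
      (-(c * exp (-‖x‖ ^ 2 / 2)) • innerSL ℝ x) x := by
  have h := (((hasStrictFDerivAt_norm_sq x).hasFDerivAt.const_mul (-(1 / 2))).exp).const_mul c
  have hfun (y : E) : -(1 / 2) * ‖y‖ ^ 2 = -‖y‖ ^ 2 / 2 := by ring
  simp only [hfun] at h
  refine h.congr_fderiv ?_
  ext y
  simp
  ring

variable [FiniteDimensional ℝ E] [MeasurableSpace E] [BorelSpace E]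

lemma integrable_exp_neg_mul_norm_sq {b : ℝ} (hb : 0 < b) :
    Integrable fun x : E => exp (-b * ‖x‖ ^ 2) := by
  have h := GaussianFourier.integrable_cexp_neg_mul_sq_norm_add (V := E) (b := (b : ℂ))
    (by simpa using hb) 0 0
  convert h.norm using 2 with x
  simp [Complex.norm_exp, ← Complex.ofReal_pow]

/-- A continuous function of polynomial growth is integrable against a Gaussian weight. -/
lemma PolyGrowth.integrable_gaussian_smul {f : E → F} (hf : PolyGrowth f) (hfc : Continuous f)
    (c : ℝ) : Integrable fun x => (c * exp (-‖x‖ ^ 2 / 2)) • f x := by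
  obtain ⟨C, hC, r, h⟩ := hf
  refine ((integrable_exp_neg_mul_norm_sq (E := E) (b := 1 / 4) (by norm_num)).const_mul
    (|c| * C * (r.factorial * exp 3))).mono' ?_ (.of_forall fun x => ?_)
  · exact Continuous.aestronglyMeasurable (by fun_prop)
  · rw [norm_smul, norm_mul, norm_eq_abs, norm_of_nonneg (exp_pos _).le]
    calc |c| * exp (-‖x‖ ^ 2 / 2) * ‖f x‖
        ≤ |c| * exp (-‖x‖ ^ 2 / 2) * (C * (1 + ‖x‖) ^ r) := by gcongr; exact h x
      _ = |c| * C * ((1 + ‖x‖) ^ r * exp (-‖x‖ ^ 2 / 2)) := by ring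
      _ ≤ |c| * C * (r.factorial * exp 3 * exp (-(1 / 4) * ‖x‖ ^ 2)) :=
        mul_le_mul_of_nonneg_left (one_add_pow_mul_exp_neg_sq_le r (norm_nonneg x)) (by positivity)
      _ = _ := by ring

/-- Stein's identity with respect to an unnormalized Gaussian density. -/
lemma integral_gaussian_smul_smul_eq_integral_gaussian_smul_gradient {g : E → ℝ}
    (hg : ContDiff ℝ 1 g) (hgrow : PolyGrowth g) (hgrow' : PolyGrowth (gradient g)) (c : ℝ) :
    ∫ x, (c * exp (-‖x‖ ^ 2 / 2)) • g x • x = ∫ x, (c * exp (-‖x‖ ^ 2 / 2)) • gradient g x := by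
  have hcont : Continuous (gradient g) :=
    (InnerProductSpace.toDual ℝ E).symm.continuous.comp (hg.continuous_fderiv (by norm_num))
  have hint := hgrow.integrable_gaussian_smul hg.continuous c
  have hint_id := hgrow.smul_id.integrable_gaussian_smul (hg.continuous.smul continuous_id) c
  have hint_grad := hgrow'.integrable_gaussian_smul hcont c
  refine ext_inner_left ℝ fun v => ?_
  rw [← integral_inner hint_id, ← integral_inner hint_grad]
  have hgauss (x : E) : fderiv ℝ (fun x : E => c * exp (-‖x‖ ^ 2 / 2)) x v =
      -(c * exp (-‖x‖ ^ 2 / 2)) * ⟪v, x⟫ := by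
    simp [(hasFDerivAt_gaussian c x).fderiv, real_inner_comm]
  have hgrad (x : E) : fderiv ℝ g x v = ⟪v, gradient g x⟫ := by
    rw [real_inner_comm, gradient, InnerProductSpace.toDual_symm_apply]
  have hleft (x : E) : ⟪v, (c * exp (-‖x‖ ^ 2 / 2)) • g x • x⟫ =
      -(g x * fderiv ℝ (fun x : E => c * exp (-‖x‖ ^ 2 / 2)) x v) := by
    rw [hgauss, real_inner_smul_right, real_inner_smul_right]
    ring
  have hright (x : E) : ⟪v, (c * exp (-‖x‖ ^ 2 / 2)) • gradient g x⟫ =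
      fderiv ℝ g x v * (c * exp (-‖x‖ ^ 2 / 2)) := by
    rw [hgrad, real_inner_smul_right]
    ring
  have hparts := integral_mul_fderiv_eq_neg_fderiv_mul_of_integrable (μ := volume) (f := g)
    (g := fun x : E => c * exp (-‖x‖ ^ 2 / 2)) (v := v)
    ((hint_grad.const_inner v).congr (.of_forall hright))
    ((hint_id.const_inner (𝕜 := ℝ) v).neg.congr
      (.of_forall fun x => by rw [Pi.neg_apply, hleft, neg_neg]))
    (hint.congr (.of_forall fun x => by simp [mul_comm]))
    (fun x _ => (hg.differentiable (by norm_num)).differentiableAt)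
    (fun x _ => (hasFDerivAt_gaussian c x).differentiableAt)
  simp_rw [hleft, hright, integral_neg, hparts, neg_neg]

end

lemma integral_stdGaussian {F : Type*} [NormedAddCommGroup F] [NormedSpace ℝ F] (n : ℕ)
    (f : EuclideanSpace ℝ (Fin n) → F) :
    ∫ x, f x ∂(stdGaussian n) =
      ∫ x, ((2 * π) ^ (-(n : ℝ) / 2) * exp (-‖x‖ ^ 2 / 2)) • f x := by
  rw [stdGaussian, integral_withDensity_eq_integral_toReal_smul (by fun_prop) (by simp)]
  congr with x
  rw [ENNReal.toReal_ofReal (by positivity)]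

/-- Gaussian integration by parts / Stein's identity: for a continuously differentiable `g`
with `g` and `∇g` of at most polynomial growth, the first-order Fourier–Hermite coefficient
`∫ g(x)·x dγₙ(x)` equals the Gaussian expectation `∫ ∇g(x) dγₙ(x)` of the gradient. -/
theorem firstOrder_fourierHermite_coefficient (n : ℕ) (g : EuclideanSpace ℝ (Fin n) → ℝ)
    (hg : ContDiff ℝ 1 g) (hgrow : PolyGrowth g) (hgrow' : PolyGrowth (gradient g)) :
    ∫ x, g x • x ∂(stdGaussian n) = ∫ x, gradient g x ∂(stdGaussian n) := by
  rw [integral_stdGaussian, integral_stdGaussian]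
  exact integral_gaussian_smul_smul_eq_integral_gaussian_smul_gradient hg hgrow hgrow' _
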